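/- Let ℓ ≥ 3 and r ≥ 3 be integers. If the generalised H-graph H^ℓ(r) admits a packing 5-colouring, then it admits a packing 5-colouring in which every edge of H^ℓ(r) has at least one endpoint of colour 1. -/

import Mathlib

/-- A packing `k`-colouring of a simple graph `G`: every vertex gets a colour in
`{1, …, k}` and any two distinct vertices sharing a colour `i` are at distance
greater than `i` in `G` (i.e. every walk joining them has length greater than `i`). -/
def IsPackingColoring {V : Type*} (G : SimpleGraph V) (k : ℕ) (π : V → ℕ) : Prop :=
  (∀ v, 1 ≤ π v ∧ π v ≤ k) ∧
    ∀ u v : V, u ≠ v → π u = π v → ∀ p : G.Walk u v, π u < p.length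

/-- The packing chromatic number of `G`: the least `k` admitting a packing `k`-colouring. -/
noncomputable def packingChromaticNumber {V : Type*} (G : SimpleGraph V) : ℕ :=
  sInf {k | ∃ π : V → ℕ, IsPackingColoring G k π}

/-- The generalised H-graph `H^ℓ(r)` with `ℓ` levels: vertices `uⁱⱼ = (i, j)` for
`i : Fin (ℓ+2)` and `j : ZMod (2*r)`; the outer cycles are on levels `0` and `ℓ+1`,
level `i` (`1 ≤ i ≤ ℓ`) carries the matching edges `uⁱ₂ⱼuⁱ₂ⱼ₊₁` (`0 ≤ j ≤ r-1`),
and `uⁱⱼ` is joined to `uⁱ⁺¹ⱼ` for `0 ≤ i ≤ ℓ`. -/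
def genHgraph (ℓ r : ℕ) : SimpleGraph (Fin (ℓ + 2) × ZMod (2 * r)) :=
  SimpleGraph.fromRel (fun x y =>
    (∃ j : ZMod (2 * r), x = ((0 : Fin (ℓ + 2)), j) ∧ y = ((0 : Fin (ℓ + 2)), j + 1)) ∨
    (∃ j : ZMod (2 * r), x = (Fin.last (ℓ + 1), j) ∧ y = (Fin.last (ℓ + 1), j + 1)) ∨
    (∃ i : Fin (ℓ + 2), ∃ j : ℕ, 1 ≤ (i : ℕ) ∧ (i : ℕ) ≤ ℓ ∧ j < r ∧
      x = (i, ((2 * j : ℕ) : ZMod (2 * r))) ∧ y = (i, ((2 * j + 1 : ℕ) : ZMod (2 * r)))) ∨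
    (∃ i : Fin (ℓ + 2), ∃ j : ZMod (2 * r), (i : ℕ) ≤ ℓ ∧ x = (i, j) ∧ y = (i + 1, j)))

/-! ### A backtracking search for colourings of a finite patch -/

/-- `colourSearch d dom vs as` decides whether the partial colouring `as` extends to the vertices
of `vs`, where `v` takes a colour from `dom v` and two vertices `v`, `w` of the same colour `c`
must satisfy `c < d v w`. -/
def colourSearch (d : ℕ × ℕ → ℕ × ℕ → ℕ) (dom : ℕ × ℕ → List ℕ) :
    List (ℕ × ℕ) → List ((ℕ × ℕ) × ℕ) → Bool
  | [], _ => true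
  | v :: vs, as => (dom v).any fun c =>
      (as.all fun a => !(Nat.beq a.2 c) || Nat.blt c (d a.1 v)) &&
        colourSearch d dom vs ((v, c) :: as)

theorem colourSearch_eq_true {d : ℕ × ℕ → ℕ × ℕ → ℕ} {dom : ℕ × ℕ → List ℕ} {f : ℕ × ℕ → ℕ}
    {vs ws : List (ℕ × ℕ)} (hdom : ∀ v ∈ vs, f v ∈ dom v)
    (hf : ∀ v ∈ ws ++ vs, ∀ w ∈ vs, v ≠ w → f v = f w → f v < d v w)
    (hnodup : (ws ++ vs).Nodup) :
    colourSearch d dom vs (ws.map fun w => (w, f w)) = true := by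
  induction vs generalizing ws with
  | nil => rfl
  | cons v vs ih =>
    have hperm : (ws ++ v :: vs).Perm ((v :: ws) ++ vs) := List.perm_middle
    simp only [colourSearch, List.any_eq_true, Bool.and_eq_true]
    refine ⟨f v, hdom v (by simp), ?_, ?_⟩
    · simp only [List.all_map, List.all_eq_true, Function.comp, Bool.or_eq_true]
      intro w hw
      by_cases h : f w = f v
      · right
        have hne : w ≠ v := by
          rintro rfl
          exact (List.nodup_append.1 hnodup).2.2 w hw w (by simp) rfl
        simpa [Nat.blt_eq, h] using hf w (by simp [hw]) v (by simp) hne h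
      · left
        simpa [← Bool.not_eq_true] using h
    · refine ih (ws := v :: ws) (fun w hw => hdom w (by simp [hw])) ?_ (hperm.nodup_iff.1 hnodup)
      intro a ha b hb
      exact hf a (hperm.mem_iff.2 ha) b (by simp [hb])

/-- Distance in the lowest rows of an `H`-graph, not using its top cycle. -/
def bottomDist (v w : ℕ × ℕ) : ℕ :=
  bif Nat.beq (v.2 / 2) (w.2 / 2) then (v.1 - w.1) + (w.1 - v.1) + ((v.2 - w.2) + (w.2 - v.2))
  else v.1 + w.1 + ((v.2 - w.2) + (w.2 - v.2))

/-- Distance in an `H`-graph whose cycles lie on the levels `0` and `6`. -/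
def sixDist (v w : ℕ × ℕ) : ℕ :=
  bif Nat.beq (v.2 / 2) (w.2 / 2) then (v.1 - w.1) + (w.1 - v.1) + ((v.2 - w.2) + (w.2 - v.2))
  else (bif Nat.ble (v.1 + w.1) 6 then v.1 + w.1 else 12 - (v.1 + w.1)) +
    ((v.2 - w.2) + (w.2 - v.2))

/-- The part of the three lowest levels searched around the columns `2` to `5`. -/
def bottomPatch : List (ℕ × ℕ) :=
  [(0, 5), (1, 5), (0, 4), (1, 4), (0, 3), (0, 2), (1, 3), (1, 2), (0, 6), (2, 3), (0, 1), (2, 2),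
    (2, 4), (2, 5), (1, 1), (0, 0), (0, 7), (1, 6), (1, 7), (2, 6), (1, 0), (2, 1)]

/-- The part of an `H`-graph with levels `0` to `6` searched around the columns `2` and `3`. -/
def sixPatch : List (ℕ × ℕ) :=
  [(1, 2), (1, 3), (0, 3), (0, 2), (2, 2), (2, 3), (3, 2), (3, 3), (4, 2), (4, 3), (5, 3), (5, 2),
    (6, 2), (6, 3), (0, 4), (0, 5), (1, 4), (1, 5), (2, 4), (2, 5), (3, 4), (3, 5), (4, 4), (4, 5),
    (5, 4), (6, 4), (5, 5), (6, 5), (0, 1), (6, 1), (5, 1), (6, 0), (5, 0), (4, 1), (4, 0), (3, 1),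
    (2, 1), (1, 1), (1, 0), (0, 0), (2, 0), (3, 0)]

/-- The colours allowed when `5` is excluded on levels `0` and `1` of the columns `2` to `5`. -/
def withoutFive (v : ℕ × ℕ) : List ℕ :=
  bif Nat.ble v.1 1 && (Nat.ble 2 v.2 && Nat.ble v.2 5) then [1, 2, 3, 4] else [1, 2, 3, 4, 5]

/-- The colours allowed when `u` has colour `5`. -/
def fiveAt (u v : ℕ × ℕ) : List ℕ :=
  bif Nat.beq u.1 v.1 && Nat.beq u.2 v.2 then [5] else [1, 2, 3, 4, 5]

theorem colourSearch_bottomPatch :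
    colourSearch bottomDist withoutFive bottomPatch [] = false := by decide +kernel

set_option maxRecDepth 100000 in
theorem colourSearch_sixPatch : ∀ u ∈ [(0, 2), (0, 3), (1, 2), (1, 3)],
    colourSearch sixDist (fiveAt u) sixPatch [] = false := by decide +kernel

/-! ### Walks in the generalised `H`-graph -/

section Walks

variable {V : Type*} {G : SimpleGraph V}

/-- There is a walk of length `n` between `u` and `v`. -/
def HasWalk (G : SimpleGraph V) (u v : V) (n : ℕ) : Prop := ∃ p : G.Walk u v, p.length = n

theorem HasWalk.symm {u v : V} {n : ℕ} (h : HasWalk G u v n) : HasWalk G v u n := by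
  obtain ⟨p, rfl⟩ := h
  exact ⟨p.reverse, by simp⟩

theorem HasWalk.trans {u v w : V} {m n : ℕ} (h : HasWalk G u v m) (h' : HasWalk G v w n) :
    HasWalk G u w (m + n) := by
  obtain ⟨p, rfl⟩ := h
  obtain ⟨q, rfl⟩ := h'
  exact ⟨p.append q, by simp⟩

theorem HasWalk.of_adj {u v : V} (h : G.Adj u v) : HasWalk G u v 1 := ⟨h.toWalk, by simp⟩

theorem HasWalk.refl (u : V) : HasWalk G u u 0 := ⟨.nil, rfl⟩

end Walks

/-- The vertex of level `i` and column `j`, the latter read modulo `2 * r`. -/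
def genHgraphVertex (ℓ r i j : ℕ) : Fin (ℓ + 2) × ZMod (2 * r) :=
  (Fin.ofNat (ℓ + 2) i, (j : ZMod (2 * r)))

theorem fin_ofNat_val {ℓ i : ℕ} (hi : i ≤ ℓ + 1) : (Fin.ofNat (ℓ + 2) i : ℕ) = i :=
  Nat.mod_eq_of_lt (by omega)

theorem fin_ofNat_succ (ℓ i : ℕ) : Fin.ofNat (ℓ + 2) (i + 1) = Fin.ofNat (ℓ + 2) i + 1 := by
  ext
  simp [Fin.val_add]

theorem zmod_ne_add_one {r : ℕ} (hr : 3 ≤ r) (j : ZMod (2 * r)) : j ≠ j + 1 := by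
  have : Fact (1 < 2 * r) := ⟨by omega⟩
  simp

section Adjacency

variable {ℓ r : ℕ}

theorem genHgraphVertex_adj_succ_level {i : ℕ} (hi : i ≤ ℓ) (j : ℕ) :
    (genHgraph ℓ r).Adj (genHgraphVertex ℓ r i j) (genHgraphVertex ℓ r (i + 1) j) := by
  have h₁ := fin_ofNat_val (show i ≤ ℓ + 1 by omega)
  have h₂ := fin_ofNat_val (show i + 1 ≤ ℓ + 1 by omega)
  refine (SimpleGraph.fromRel_adj _ _ _).2 ⟨fun h => ?_, Or.inl (Or.inr (Or.inr (Or.inr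
    ⟨Fin.ofNat (ℓ + 2) i, j, by omega, rfl, by simp only [genHgraphVertex, fin_ofNat_succ]⟩)))⟩
  have := congrArg (fun x => (x.1 : ℕ)) h
  simp only [genHgraphVertex] at this
  omega

theorem genHgraphVertex_adj_bottom (hr : 3 ≤ r) (j : ℕ) :
    (genHgraph ℓ r).Adj (genHgraphVertex ℓ r 0 j) (genHgraphVertex ℓ r 0 (j + 1)) := by
  refine (SimpleGraph.fromRel_adj _ _ _).2 ⟨fun h => ?_, Or.inl (Or.inl ⟨j, ?_, ?_⟩)⟩
  · exact zmod_ne_add_one hr j (by simpa [genHgraphVertex] using congrArg Prod.snd h)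
  · rfl
  · simp only [genHgraphVertex, Nat.cast_add, Nat.cast_one]
    rfl

theorem genHgraphVertex_adj_top (hr : 3 ≤ r) (j : ℕ) :
    (genHgraph ℓ r).Adj (genHgraphVertex ℓ r (ℓ + 1) j)
      (genHgraphVertex ℓ r (ℓ + 1) (j + 1)) := by
  have h₁ : Fin.ofNat (ℓ + 2) (ℓ + 1) = Fin.last (ℓ + 1) := Fin.ext (fin_ofNat_val le_rfl)
  refine (SimpleGraph.fromRel_adj _ _ _).2 ⟨fun h => ?_, Or.inl (Or.inr (Or.inl ⟨j, ?_, ?_⟩))⟩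
  · exact zmod_ne_add_one hr j (by simpa [genHgraphVertex] using congrArg Prod.snd h)
  · simp only [genHgraphVertex, h₁]
  · simp only [genHgraphVertex, Nat.cast_add, Nat.cast_one, h₁]

theorem genHgraphVertex_add_mul (i j : ℕ) :
    genHgraphVertex ℓ r i (j + 2 * r) = genHgraphVertex ℓ r i j := by
  simp only [genHgraphVertex, Nat.cast_add, ZMod.natCast_self, add_zero]

theorem genHgraphVertex_adj_rung (hr : 3 ≤ r) {i : ℕ} (hi : i ≤ ℓ + 1) (m : ℕ) :
    (genHgraph ℓ r).Adj (genHgraphVertex ℓ r i (2 * m)) (genHgraphVertex ℓ r i (2 * m + 1)) := by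
  rcases Nat.eq_zero_or_pos i with rfl | hi₀
  · exact genHgraphVertex_adj_bottom hr _
  rcases Nat.eq_or_lt_of_le hi with rfl | hi₁
  · exact genHgraphVertex_adj_top hr _
  have h₁ := fin_ofNat_val hi
  have hm : ((2 * (m % r) : ℕ) : ZMod (2 * r)) = ((2 * m : ℕ) : ZMod (2 * r)) := by
    rw [← Nat.mul_mod_mul_left, ZMod.natCast_mod]
  refine (SimpleGraph.fromRel_adj _ _ _).2 ⟨fun h => ?_, Or.inl (Or.inr (Or.inr (Or.inl
    ⟨Fin.ofNat (ℓ + 2) i, m % r, by omega, by omega, Nat.mod_lt _ (by omega), ?_, ?_⟩)))⟩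
  · exact zmod_ne_add_one hr ((2 * m : ℕ) : ZMod (2 * r))
      (by simpa [genHgraphVertex] using congrArg Prod.snd h)
  · simp only [genHgraphVertex, hm]
  · simp only [genHgraphVertex, Nat.cast_add, hm]

theorem hasWalk_vertical {i d : ℕ} (h : i + d ≤ ℓ + 1) (j : ℕ) :
    HasWalk (genHgraph ℓ r) (genHgraphVertex ℓ r i j) (genHgraphVertex ℓ r (i + d) j) d := by
  induction d with
  | zero => exact .refl _
  | succ d ih =>
    exact (ih (by omega)).trans (.of_adj (genHgraphVertex_adj_succ_level (by omega) j))

theorem hasWalk_level_dist {i i' : ℕ} (hi : i ≤ ℓ + 1) (hi' : i' ≤ ℓ + 1) (j : ℕ) :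
    HasWalk (genHgraph ℓ r) (genHgraphVertex ℓ r i j) (genHgraphVertex ℓ r i' j)
      ((i - i') + (i' - i)) := by
  rcases Nat.le_total i i' with h | h
  · obtain ⟨d, rfl⟩ := Nat.exists_eq_add_of_le h
    simpa using hasWalk_vertical hi' j
  · obtain ⟨d, rfl⟩ := Nat.exists_eq_add_of_le h
    simpa using (hasWalk_vertical hi j).symm

theorem hasWalk_horizontal {i : ℕ}
    (hadj : ∀ j, (genHgraph ℓ r).Adj (genHgraphVertex ℓ r i j) (genHgraphVertex ℓ r i (j + 1)))
    (j j' : ℕ) :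
    HasWalk (genHgraph ℓ r) (genHgraphVertex ℓ r i j) (genHgraphVertex ℓ r i j')
      ((j - j') + (j' - j)) := by
  have key (j d : ℕ) :
      HasWalk (genHgraph ℓ r) (genHgraphVertex ℓ r i j) (genHgraphVertex ℓ r i (j + d)) d := by
    induction d with
    | zero => exact .refl _
    | succ d ih => exact ih.trans (.of_adj (hadj _))
  rcases Nat.le_total j j' with h | h
  · obtain ⟨d, rfl⟩ := Nat.exists_eq_add_of_le h
    simpa using key j d
  · obtain ⟨d, rfl⟩ := Nat.exists_eq_add_of_le h
    simpa using (key j' d).symm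

theorem hasWalk_ladder (hr : 3 ≤ r) {i i' j j' : ℕ} (hi : i ≤ ℓ + 1) (hi' : i' ≤ ℓ + 1)
    (hj : j / 2 = j' / 2) :
    HasWalk (genHgraph ℓ r) (genHgraphVertex ℓ r i j) (genHgraphVertex ℓ r i' j')
      ((i - i') + (i' - i) + ((j - j') + (j' - j))) := by
  refine (hasWalk_level_dist hi hi' j).trans ?_
  have h := HasWalk.of_adj (genHgraphVertex_adj_rung hr hi' (j / 2))
  obtain rfl | ⟨h₁, h₂⟩ | ⟨h₁, h₂⟩ : j = j' ∨ (j = 2 * (j / 2) ∧ j' = 2 * (j / 2) + 1) ∨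
      (j' = 2 * (j / 2) ∧ j = 2 * (j / 2) + 1) := by omega
  · simpa using HasWalk.refl _
  · rw [← h₂, ← h₁] at h
    rwa [show (j - j') + (j' - j) = 1 by omega]
  · rw [← h₂, ← h₁] at h
    rw [show (j - j') + (j' - j) = 1 by omega]
    exact h.symm

theorem hasWalk_bottom (hr : 3 ≤ r) {i i' : ℕ} (hi : i ≤ ℓ + 1) (hi' : i' ≤ ℓ + 1) (j j' : ℕ) :
    HasWalk (genHgraph ℓ r) (genHgraphVertex ℓ r i j) (genHgraphVertex ℓ r i' j')
      (i + i' + ((j - j') + (j' - j))) := by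
  have h₁ := hasWalk_level_dist (r := r) hi (Nat.zero_le (ℓ + 1)) j
  have h₂ := hasWalk_horizontal (ℓ := ℓ) (genHgraphVertex_adj_bottom hr) j j'
  have h₃ := hasWalk_level_dist (r := r) (Nat.zero_le (ℓ + 1)) hi' j'
  convert (h₁.trans h₂).trans h₃ using 1
  omega

theorem hasWalk_top (hr : 3 ≤ r) {i i' : ℕ} (hi : i ≤ ℓ + 1) (hi' : i' ≤ ℓ + 1) (j j' : ℕ) :
    HasWalk (genHgraph ℓ r) (genHgraphVertex ℓ r i j) (genHgraphVertex ℓ r i' j')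
      (2 * (ℓ + 1) - (i + i') + ((j - j') + (j' - j))) := by
  have h₁ := hasWalk_level_dist (r := r) hi (le_refl (ℓ + 1)) j
  have h₂ := hasWalk_horizontal (ℓ := ℓ) (genHgraphVertex_adj_top hr) j j'
  have h₃ := hasWalk_level_dist (r := r) (le_refl (ℓ + 1)) hi' j'
  convert (h₁.trans h₂).trans h₃ using 1
  omega

theorem natBeq_eq_false {a b : ℕ} (h : a ≠ b) : Nat.beq a b = false := by
  simpa [← Bool.not_eq_true] using h

theorem natBle_eq_false {a b : ℕ} (h : ¬a ≤ b) : Nat.ble a b = false := by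
  simpa [← Bool.not_eq_true, Nat.ble_eq] using h

theorem hasWalk_bottomDist (hr : 3 ≤ r) {v w : ℕ × ℕ} (hv : v.1 ≤ ℓ + 1) (hw : w.1 ≤ ℓ + 1)
    (k : ℕ) :
    HasWalk (genHgraph ℓ r) (genHgraphVertex ℓ r v.1 (2 * k + v.2))
      (genHgraphVertex ℓ r w.1 (2 * k + w.2)) (bottomDist v w) := by
  unfold bottomDist
  by_cases h : v.2 / 2 = w.2 / 2
  · convert hasWalk_ladder hr hv hw (show (2 * k + v.2) / 2 = (2 * k + w.2) / 2 by omega) using 1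
    simp only [h, Nat.beq_refl, cond_true]
    omega
  · convert hasWalk_bottom hr hv hw (2 * k + v.2) (2 * k + w.2) using 1
    simp only [natBeq_eq_false h, cond_false]
    omega

theorem hasWalk_sixDist (hr : 3 ≤ r) {v w : ℕ × ℕ} (hv : v.1 ≤ 6) (hw : w.1 ≤ 6) (k : ℕ) :
    HasWalk (genHgraph 5 r) (genHgraphVertex 5 r v.1 (2 * k + v.2))
      (genHgraphVertex 5 r w.1 (2 * k + w.2)) (sixDist v w) := by
  unfold sixDist
  by_cases h : v.2 / 2 = w.2 / 2
  · convert hasWalk_ladder hr hv hw (show (2 * k + v.2) / 2 = (2 * k + w.2) / 2 by omega) using 1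
    simp only [h, Nat.beq_refl, cond_true]
    omega
  · by_cases h' : v.1 + w.1 ≤ 6
    · convert hasWalk_bottom hr hv hw (2 * k + v.2) (2 * k + w.2) using 1
      simp only [natBeq_eq_false h, Nat.ble_eq_true_of_le h', cond_false, cond_true]
      omega
    · convert hasWalk_top hr hv hw (2 * k + v.2) (2 * k + w.2) using 1
      simp only [natBeq_eq_false h, natBle_eq_false h', cond_false]
      omega

theorem genHgraphVertex_ne {i i' j j' : ℕ} (hi : i ≤ ℓ + 1) (hi' : i' ≤ ℓ + 1)
    (hne : (i, j) ≠ (i', j')) (hj : (j - j') + (j' - j) < 2 * r) :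
    genHgraphVertex ℓ r i j ≠ genHgraphVertex ℓ r i' j' := by
  intro h
  have h₁ : i = i' := by
    have := congrArg (fun x => (x.1 : ℕ)) h
    simpa only [genHgraphVertex, fin_ofNat_val hi, fin_ofNat_val hi'] using this
  have h₂ := (ZMod.natCast_eq_natCast_iff' _ _ _).1 (congrArg Prod.snd h)
  have h₃ : j ≠ j' := fun h => hne (by rw [h₁, h])
  rcases Nat.le_total j j' with h₄ | h₄
  · have := Nat.le_of_dvd (by omega) ((Nat.modEq_iff_dvd' h₄).1 h₂)
    omega
  · have := Nat.le_of_dvd (by omega) ((Nat.modEq_iff_dvd' h₄).1 h₂.symm)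
    omega

end Adjacency

/-! ### Where packing `5`-colourings do not exist -/

section Nonexistence

variable {ℓ r : ℕ} {π : Fin (ℓ + 2) × ZMod (2 * r) → ℕ}

theorem IsPackingColoring.lt_of_hasWalk (hπ : IsPackingColoring (genHgraph ℓ r) 5 π) (hr : 3 ≤ r)
    {i i' j j' n : ℕ} (hi : i ≤ ℓ + 1) (hi' : i' ≤ ℓ + 1) (hne : (i, j) ≠ (i', j'))
    (heq : π (genHgraphVertex ℓ r i j) = π (genHgraphVertex ℓ r i' j'))
    (hn : HasWalk (genHgraph ℓ r) (genHgraphVertex ℓ r i j) (genHgraphVertex ℓ r i' j') n)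
    (hj : (j - j') + (j' - j) ≤ n) : π (genHgraphVertex ℓ r i j) < n := by
  by_contra! h
  have h₅ := (hπ.1 (genHgraphVertex ℓ r i j)).2
  obtain ⟨p, rfl⟩ := hn
  have := hπ.2 _ _ (genHgraphVertex_ne hi hi' hne (by omega)) heq p
  omega

/-- Some vertex on the two lowest levels of the `m`-th ladder has colour `5`. -/
def FiveAtBottom (π : Fin (ℓ + 2) × ZMod (2 * r) → ℕ) (m : ℕ) : Prop :=
  ∃ i ≤ 1, ∃ j ≤ 1, π (genHgraphVertex ℓ r i (2 * m + j)) = 5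

theorem abs_sub_le_bottomDist (v w : ℕ × ℕ) : (v.2 - w.2) + (w.2 - v.2) ≤ bottomDist v w := by
  unfold bottomDist
  cases Nat.beq (v.2 / 2) (w.2 / 2) <;> simp only [cond_true, cond_false] <;> omega

theorem abs_sub_le_sixDist (v w : ℕ × ℕ) : (v.2 - w.2) + (w.2 - v.2) ≤ sixDist v w := by
  unfold sixDist
  cases Nat.beq (v.2 / 2) (w.2 / 2) <;> simp only [cond_true, cond_false] <;> omega

theorem IsPackingColoring.mem_range (hπ : IsPackingColoring (genHgraph ℓ r) 5 π)
    (x : Fin (ℓ + 2) × ZMod (2 * r)) : π x ∈ [1, 2, 3, 4, 5] := by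
  have := hπ.1 x
  simp only [List.mem_cons, List.not_mem_nil, or_false]
  omega

theorem fiveAtBottom_or_succ (hπ : IsPackingColoring (genHgraph ℓ r) 5 π) (hr : 3 ≤ r)
    (hℓ : 3 ≤ ℓ) (m : ℕ) : FiveAtBottom π (m + 1) ∨ FiveAtBottom π (m + 2) := by
  by_contra! hno
  have hlevel : ∀ v ∈ bottomPatch, v.1 ≤ ℓ + 1 := fun v hv =>
    ((by decide : ∀ v ∈ bottomPatch, v.1 ≤ 2) v hv).trans (by omega)
  have h := colourSearch_eq_true (d := bottomDist) (dom := withoutFive) (vs := bottomPatch)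
    (ws := []) (f := fun v => π (genHgraphVertex ℓ r v.1 (2 * m + v.2))) ?_ ?_ (by decide)
  · rw [List.map_nil, colourSearch_bottomPatch] at h
    exact Bool.false_ne_true h
  · intro v _
    have hmem := hπ.mem_range (genHgraphVertex ℓ r v.1 (2 * m + v.2))
    by_cases hv : v.1 ≤ 1 ∧ 2 ≤ v.2 ∧ v.2 ≤ 5
    · have hdom : withoutFive v = [1, 2, 3, 4] := by
        simp only [withoutFive, Nat.ble_eq_true_of_le hv.1, Nat.ble_eq_true_of_le hv.2.1,
          Nat.ble_eq_true_of_le hv.2.2, Bool.and_self, cond_true]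
      rw [hdom]
      have h₅ : π (genHgraphVertex ℓ r v.1 (2 * m + v.2)) ≠ 5 := by
        intro h₅
        rcases Nat.lt_or_ge v.2 4 with h₄ | h₄
        · exact hno.1 ⟨v.1, hv.1, v.2 - 2, by omega, by
            rw [← h₅, show 2 * (m + 1) + (v.2 - 2) = 2 * m + v.2 by omega]⟩
        · exact hno.2 ⟨v.1, hv.1, v.2 - 4, by omega, by
            rw [← h₅, show 2 * (m + 2) + (v.2 - 4) = 2 * m + v.2 by omega]⟩
      simp only [List.mem_cons, List.not_mem_nil, or_false] at hmem ⊢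
      tauto
    · have hdom : withoutFive v = [1, 2, 3, 4, 5] := by
        have : (Nat.ble v.1 1 && (Nat.ble 2 v.2 && Nat.ble v.2 5)) = false := by
          simpa [← Bool.not_eq_true, Nat.ble_eq] using hv
        rw [withoutFive, this, cond_false]
      rwa [hdom]
  · intro v hv w hw hne heq
    exact hπ.lt_of_hasWalk hr (hlevel v hv) (hlevel w hw)
      (j := 2 * m + v.2) (j' := 2 * m + w.2)
      (fun h => hne (by simpa [Prod.ext_iff] using h)) heq
      (hasWalk_bottomDist hr (hlevel v hv) (hlevel w hw) m)
      (by have := abs_sub_le_bottomDist v w; omega)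

theorem not_fiveAtBottom_and_succ (hπ : IsPackingColoring (genHgraph ℓ r) 5 π) (hr : 3 ≤ r)
    (m : ℕ) : ¬(FiveAtBottom π m ∧ FiveAtBottom π (m + 1)) := by
  rintro ⟨⟨i, hi, j, hj, h⟩, ⟨i', hi', j', hj', h'⟩⟩
  have := hπ.lt_of_hasWalk hr (show i ≤ ℓ + 1 by omega) (show i' ≤ ℓ + 1 by omega)
    (by simp only [ne_eq, Prod.mk.injEq]; omega) (h.trans h'.symm)
    (hasWalk_bottom hr (by omega) (by omega) _ _) (by omega)
  omega

theorem fiveAtBottom_add (m : ℕ) : FiveAtBottom π (m + r) ↔ FiveAtBottom π m := by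
  unfold FiveAtBottom
  simp only [show ∀ j, 2 * (m + r) + j = 2 * m + j + 2 * r by intro j; ring,
    genHgraphVertex_add_mul]

theorem even_of_isPackingColoring_five (hπ : IsPackingColoring (genHgraph ℓ r) 5 π) (hr : 3 ≤ r)
    (hℓ : 3 ≤ ℓ) : Even r := by
  have hstep (m : ℕ) : FiveAtBottom π (m + 2) ↔ ¬FiveAtBottom π (m + 1) :=
    ⟨fun h h' => not_fiveAtBottom_and_succ hπ hr (m + 1) ⟨h', h⟩,
      (fiveAtBottom_or_succ hπ hr hℓ m).resolve_left⟩
  have hparity (n : ℕ) : (FiveAtBottom π (n + 1) ↔ FiveAtBottom π 1) ↔ Even n := by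
    induction n with
    | zero => simp
    | succ n ih =>
      rw [Nat.even_add_one, ← ih, hstep]
      tauto
  exact (hparity r).1 (by rw [add_comm r, fiveAtBottom_add])

theorem not_isPackingColoring_five_genHgraph_five {π : Fin (5 + 2) × ZMod (2 * r) → ℕ}
    (hr : 3 ≤ r) : ¬IsPackingColoring (genHgraph 5 r) 5 π := by
  intro hπ
  obtain ⟨k, i, hi, j, hj, h₅⟩ : ∃ k, FiveAtBottom π (k + 1) := by
    rcases fiveAtBottom_or_succ hπ hr (by omega) 0 with h | h
    exacts [⟨_, h⟩, ⟨_, h⟩]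
  have hlevel : ∀ v ∈ sixPatch, v.1 ≤ 6 := by decide
  have h := colourSearch_eq_true (d := sixDist) (dom := fiveAt (i, j + 2)) (vs := sixPatch)
    (ws := []) (f := fun v => π (genHgraphVertex 5 r v.1 (2 * k + v.2))) ?_ ?_ (by decide)
  · rw [List.map_nil, colourSearch_sixPatch] at h
    · exact Bool.false_ne_true h
    · interval_cases i <;> interval_cases j <;> simp
  · intro v _
    have hmem := hπ.mem_range (genHgraphVertex 5 r v.1 (2 * k + v.2))
    by_cases hv : i = v.1 ∧ j + 2 = v.2
    · have hdom : fiveAt (i, j + 2) v = [5] := by simp [fiveAt, hv]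
      rw [hdom, ← hv.1, ← hv.2, show 2 * k + (j + 2) = 2 * (k + 1) + j by ring, h₅]
      simp
    · have hdom : fiveAt (i, j + 2) v = [1, 2, 3, 4, 5] := by
        have : (Nat.beq i v.1 && Nat.beq (j + 2) v.2) = false := by
          simpa [← Bool.not_eq_true, Nat.beq_eq] using hv
        simp only [fiveAt, this, cond_false]
      rwa [hdom]
  · intro v hv w hw hne heq
    exact hπ.lt_of_hasWalk hr (hlevel v hv) (hlevel w hw)
      (j := 2 * k + v.2) (j' := 2 * k + w.2)
      (fun h => hne (by simpa [Prod.ext_iff] using h)) heq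
      (hasWalk_sixDist hr (hlevel v hv) (hlevel w hw) k)
      (by have := abs_sub_le_sixDist v w; omega)

end Nonexistence

/-! ### Packing `5`-colourings of `H^ℓ(r)` for even `r` and `ℓ ≠ 5` -/

/-- `s i` is the colour other than `1` used on level `i` of a ladder whose last level is `L`. -/
structure IsLadderWord (L : ℕ) (s : ℕ → ℕ) : Prop where
  range : ∀ i, 2 ≤ s i ∧ s i ≤ 5
  gap : ∀ i i', i < i' → i' ≤ L → s i = s i' → i + 3 ≤ i' ∧ (4 ≤ s i → i + 5 ≤ i')
  zero : s 0 ≤ 3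
  one : 4 ≤ s 1
  two : s 2 ≤ 3
  last : s L ≤ 3
  last_sub_one : 4 ≤ s (L - 1)
  last_sub_two : s (L - 2) ≤ 3

set_option maxHeartbeats 2000000 in
theorem exists_isLadderWord {L : ℕ} (hL : 4 ≤ L) (hL₆ : L ≠ 6) : ∃ s, IsLadderWord L s := by
  obtain h | h | h : L % 3 = 2 ∨ L % 3 = 1 ∨ (L % 3 = 0 ∧ 9 ≤ L) := by omega
  · refine ⟨fun i => if i % 3 = 0 then 2 else if i % 3 = 2 then 3 else
      if i % 6 = 1 then 5 else 4, ?_, ?_, ?_, ?_, ?_, ?_, ?_, ?_⟩ <;> grind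
  · refine ⟨fun i => if i = 0 then 2 else if i = 1 then 5 else if i = 2 then 3 else
      if i % 3 = 1 then 2 else if i % 3 = 2 then 3 else if i % 6 = 0 then 5 else 4,
      ?_, ?_, ?_, ?_, ?_, ?_, ?_, ?_⟩ <;> intros <;> split_ifs at * <;> omega
  · obtain ⟨s, hs⟩ : ∃ s : ℕ → ℕ, ∀ i, s i = if i = 0 then 2 else if i = 1 then 5 else
        if i = 2 then 3 else if i = L then 3 else
        if i + 1 = L then (if L % 6 = 3 then 4 else 5) else
        if i % 3 = 1 then 2 else if i % 3 = 2 then 3 else if i % 6 = 0 then 5 else 4 :=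
      ⟨_, fun _ => rfl⟩
    have hcases (i : ℕ) : (s i = 2 ∧ (i = 0 ∨ i % 3 = 1 ∧ 4 ≤ i ∧ i ≠ L)) ∨
        (s i = 3 ∧ (i = L ∨ i % 3 = 2 ∧ i + 1 ≠ L)) ∨
        (s i = 4 ∧ (i + 1 = L ∧ L % 6 = 3 ∨ i % 6 = 3 ∧ i ≠ L)) ∨
        (s i = 5 ∧ (i = 1 ∨ i + 1 = L ∧ L % 6 = 0 ∨ i % 6 = 0 ∧ i ≠ 0 ∧ i ≠ L)) := by
      have := hs i
      split_ifs at this <;> omega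
    refine ⟨s, fun i => ?_, fun i i' hlt hle heq => ?_, ?_, ?_, ?_, ?_, ?_, ?_⟩
    · have := hcases i
      omega
    · rcases hcases i with h₁ | h₁ | h₁ | h₁ <;> rcases hcases i' with h₂ | h₂ | h₂ | h₂ <;> omega
    · have := hcases 0
      omega
    · have := hcases 1
      omega
    · have := hcases 2
      omega
    · have := hcases L
      omega
    · have := hcases (L - 1)
      omega
    · have := hcases (L - 2)
      omega

/-- Exchange the colours `2` and `3`, and the colours `4` and `5`. -/
def swapColour (c : ℕ) : ℕ := if c % 2 = 0 then c + 1 else c - 1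

/-- The colour of level `i` and (integer) column `j` in the colouring built from `s`. -/
def ladderColour (s : ℕ → ℕ) (i : ℕ) (j : ℤ) : ℕ :=
  if (i + j) % 2 = 0 then 1 else if j % 4 < 2 then s i else swapColour (s i)

/-- Adjacency between (level, integer column) pairs covering the generalised `H`-graph. -/
def LiftAdj (L : ℕ) (i : ℕ) (a : ℤ) (i' : ℕ) (b : ℤ) : Prop :=
  (b = a ∧ (i' = i + 1 ∨ i = i' + 1)) ∨
    (i = i' ∧ (a = b + 1 ∨ b = a + 1) ∧ (a / 2 = b / 2 ∨ i = 0 ∨ i = L))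

/-- A necessary condition for two (level, integer column) pairs to be joined by a walk of
length `n`. -/
def LiftBound (L n : ℕ) (i : ℕ) (a : ℤ) (i' : ℕ) (b : ℤ) : Prop :=
  (a / 2 = b / 2 ∧ ((i : ℤ) - i').natAbs + (a - b).natAbs ≤ n) ∨
    (a / 2 ≠ b / 2 ∧ i + i' + (a - b).natAbs ≤ n) ∨
    (a / 2 ≠ b / 2 ∧ 2 * L + (a - b).natAbs ≤ n + i + i') ∨ L + 2 ≤ n

theorem LiftAdj.liftBound_succ {L n i i' i'' : ℕ} {a b c : ℤ} (hi : i ≤ L) (hi' : i' ≤ L)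
    (hi'' : i'' ≤ L) (h : LiftAdj L i a i' b) (h' : LiftBound L n i' b i'' c) :
    LiftBound L (n + 1) i a i'' c := by
  unfold LiftAdj at h
  unfold LiftBound at h' ⊢
  rcases h with ⟨rfl, rfl | rfl⟩ | ⟨rfl, rfl | rfl, h⟩ <;> omega

theorem ladderColour_range {L : ℕ} {s : ℕ → ℕ} (hs : IsLadderWord L s) (i : ℕ) (j : ℤ) :
    1 ≤ ladderColour s i j ∧ ladderColour s i j ≤ 5 := by
  have := hs.range i
  unfold ladderColour swapColour
  grind

theorem LiftAdj.ladderColour_eq_one {L i i' : ℕ} {a b : ℤ} (h : LiftAdj L i a i' b)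
    (s : ℕ → ℕ) : ladderColour s i a = 1 ∨ ladderColour s i' b = 1 := by
  unfold LiftAdj at h
  obtain h' | h' : ((i : ℤ) + a) % 2 = 0 ∨ ((i' : ℤ) + b) % 2 = 0 := by omega
  · exact Or.inl (if_pos h')
  · exact Or.inr (if_pos h')

set_option maxHeartbeats 2000000 in
theorem LiftBound.eq_of_ladderColour_eq {L n i i' : ℕ} {a b : ℤ} {s : ℕ → ℕ} (hL : 4 ≤ L)
    (hs : IsLadderWord L s) (hi : i ≤ L) (hi' : i' ≤ L) (h : LiftBound L n i a i' b)
    (heq : ladderColour s i a = ladderColour s i' b) (hn : n ≤ ladderColour s i a) :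
    i = i' ∧ a = b := by
  have hs₀ := hs.range i
  have hs₀' := hs.range i'
  unfold LiftBound at h
  by_cases hpar : ((i : ℤ) + a) % 2 = 0
  · have h₁ : ladderColour s i a = 1 := if_pos hpar
    have hpar' : ((i' : ℤ) + b) % 2 = 0 := by
      unfold ladderColour swapColour at heq
      grind
    omega
  have hpar' : ((i' : ℤ) + b) % 2 ≠ 0 := by
    unfold ladderColour swapColour at heq
    grind
  have hcol : (s i ≤ 3 ↔ ladderColour s i a ≤ 3) ∧ (s i' ≤ 3 ↔ ladderColour s i a ≤ 3) ∧
      ladderColour s i a ≤ 5 ∧ (s i = s i' ↔ (a % 4 < 2 ↔ b % 4 < 2)) := by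
    unfold ladderColour swapColour at *
    grind
  obtain ⟨h₁, h₁', h₅, hiff⟩ := hcol
  rcases h with ⟨hab, h⟩ | ⟨hab, h⟩ | ⟨hab, h⟩ | h
  · have hss : s i = s i' := hiff.2 (by omega)
    rcases lt_trichotomy i i' with hlt | rfl | hlt
    · have := hs.gap _ _ hlt hi' hss
      omega
    · omega
    · have := hs.gap _ _ hlt hi hss.symm
      omega
  · obtain ⟨-, -, hz, ho, ht, -, -, -⟩ := hs
    have hi₃ : i ≤ 3 := by omega
    have hi₃' : i' ≤ 3 := by omega
    interval_cases i <;> interval_cases i' <;> omega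
  · obtain ⟨-, -, -, -, -, hz, ho, ht⟩ := hs
    replace hz : s (L - 0) ≤ 3 := hz
    obtain ⟨e, he, rfl⟩ : ∃ e ≤ 3, i = L - e := ⟨L - i, by omega, by omega⟩
    obtain ⟨e', he', rfl⟩ : ∃ e' ≤ 3, i' = L - e' := ⟨L - i', by omega, by omega⟩
    interval_cases e <;> interval_cases e' <;> omega
  · omega

theorem genHgraph_liftAdj {ℓ r : ℕ} {x y : Fin (ℓ + 2) × ZMod (2 * r)}
    (h : (genHgraph ℓ r).Adj x y) {a : ℤ} (ha : (a : ZMod (2 * r)) = x.2) :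
    ∃ b : ℤ, (b : ZMod (2 * r)) = y.2 ∧ LiftAdj (ℓ + 1) x.1 a y.1 b := by
  have hparity (k : ℕ) (c : ℤ) (hc : (c : ZMod (2 * r)) = (k : ZMod (2 * r))) :
      c % 2 = (k : ℤ) % 2 := by
    have := (ZMod.intCast_eq_intCast_iff_dvd_sub c k (2 * r)).1 (by simpa using hc)
    have := (Dvd.intro (r : ℤ) (by push_cast; rfl) : (2 : ℤ) ∣ ((2 * r : ℕ) : ℤ)).trans this
    omega
  have hval {i : Fin (ℓ + 2)} (hi : (i : ℕ) ≤ ℓ) : ((i + 1 : Fin (ℓ + 2)) : ℕ) = i + 1 :=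
    Fin.val_add_one_of_lt (Fin.lt_def.2 (by simp only [Fin.val_last]; omega))
  obtain ⟨-, h | h⟩ := (SimpleGraph.fromRel_adj _ _ _).1 h
  · obtain ⟨j, rfl, rfl⟩ | ⟨j, rfl, rfl⟩ | ⟨i, j, -, -, -, rfl, rfl⟩ | ⟨i, j, hi, rfl, rfl⟩ := h
    · exact ⟨a + 1, by simp [ha], by simp [LiftAdj]⟩
    · exact ⟨a + 1, by simp [ha], by simp [LiftAdj]⟩
    · have := hparity _ a ha
      exact ⟨a + 1, by simp [ha], Or.inr ⟨rfl, by omega, by omega⟩⟩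
    · exact ⟨a, ha, Or.inl ⟨rfl, Or.inl (hval hi)⟩⟩
  · obtain ⟨j, rfl, rfl⟩ | ⟨j, rfl, rfl⟩ | ⟨i, j, -, -, -, rfl, rfl⟩ | ⟨i, j, hi, rfl, rfl⟩ := h
    · exact ⟨a - 1, by simp [ha], by simp [LiftAdj]⟩
    · exact ⟨a - 1, by simp [ha], by simp [LiftAdj]⟩
    · have := hparity _ a ha
      exact ⟨a - 1, by simp [ha], Or.inr ⟨rfl, by omega, by omega⟩⟩
    · exact ⟨a, ha, Or.inl ⟨rfl, Or.inr (hval hi)⟩⟩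

theorem genHgraph_liftBound {ℓ r : ℕ} {x y : Fin (ℓ + 2) × ZMod (2 * r)}
    (p : (genHgraph ℓ r).Walk x y) {a : ℤ} (ha : (a : ZMod (2 * r)) = x.2) :
    ∃ b : ℤ, (b : ZMod (2 * r)) = y.2 ∧ LiftBound (ℓ + 1) p.length x.1 a y.1 b := by
  induction p generalizing a with
  | nil => exact ⟨a, ha, by simp [LiftBound]⟩
  | @cons x v y h p ih =>
    obtain ⟨b, hb, hadj⟩ := genHgraph_liftAdj h ha
    obtain ⟨c, hc, hbound⟩ := ih hb
    have hlevel (z : Fin (ℓ + 2) × ZMod (2 * r)) : (z.1 : ℕ) ≤ ℓ + 1 := by omega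
    exact ⟨c, hc, hadj.liftBound_succ (hlevel x) (hlevel v) (hlevel y) hbound⟩

theorem exists_isPackingColoring_five_of_even {ℓ r : ℕ} (hℓ : 3 ≤ ℓ) (hℓ₅ : ℓ ≠ 5)
    (hr : Even r) (hr₀ : r ≠ 0) :
    ∃ π : Fin (ℓ + 2) × ZMod (2 * r) → ℕ, IsPackingColoring (genHgraph ℓ r) 5 π ∧
      ∀ x y, (genHgraph ℓ r).Adj x y → π x = 1 ∨ π y = 1 := by
  have : NeZero (2 * r) := ⟨by omega⟩
  obtain ⟨s, hs⟩ := exists_isLadderWord (L := ℓ + 1) (by omega) (by omega)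
  have hcast (x : ZMod (2 * r)) : (((x.val : ℕ) : ℤ) : ZMod (2 * r)) = x := by simp
  have hlift (i : ℕ) (b : ℤ) :
      ladderColour s i ((b : ZMod (2 * r)).val : ℤ) = ladderColour s i b := by
    obtain ⟨q, rfl⟩ := hr
    have h : (b % ((2 * (q + q) : ℕ) : ℤ)) % 4 = b % 4 :=
      Int.emod_emod_of_dvd _ ⟨q, by push_cast; ring⟩
    rw [ZMod.val_intCast]
    generalize b % ((2 * (q + q) : ℕ) : ℤ) = c at h
    unfold ladderColour
    rw [h, show ((i : ℤ) + c) % 2 = (i + b) % 2 by omega]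
  refine ⟨fun x => ladderColour s x.1 (x.2.val : ℤ), ⟨fun x => ladderColour_range hs _ _, ?_⟩, ?_⟩
  · intro x y hne heq p
    by_contra! hlt
    obtain ⟨b, hb, hbound⟩ := genHgraph_liftBound p (hcast x.2)
    change ladderColour s x.1 x.2.val = ladderColour s y.1 y.2.val at heq
    rw [← hb, hlift] at heq
    have hlevel (z : Fin (ℓ + 2) × ZMod (2 * r)) : (z.1 : ℕ) ≤ ℓ + 1 := by omega
    obtain ⟨h₁, h₂⟩ := hbound.eq_of_ladderColour_eq (by omega) hs (hlevel x) (hlevel y) heq hlt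
    exact hne (Prod.ext (Fin.ext h₁) (by rw [← hb, ← h₂, hcast]))
  · intro x y hadj
    obtain ⟨b, hb, h⟩ := genHgraph_liftAdj hadj (hcast x.2)
    have := h.ladderColour_eq_one s
    rwa [← hlift (y.1 : ℕ) b, hb] at this

theorem genHgraph_exists_colour_one_on_edges (ℓ r : ℕ) (hℓ : 3 ≤ ℓ) (hr : 3 ≤ r)
    (h : ∃ π : Fin (ℓ + 2) × ZMod (2 * r) → ℕ, IsPackingColoring (genHgraph ℓ r) 5 π) :
    ∃ π : Fin (ℓ + 2) × ZMod (2 * r) → ℕ, IsPackingColoring (genHgraph ℓ r) 5 π ∧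
      ∀ x y : Fin (ℓ + 2) × ZMod (2 * r), (genHgraph ℓ r).Adj x y →
        π x = 1 ∨ π y = 1 := by
  obtain ⟨π, hπ⟩ := h
  refine exists_isPackingColoring_five_of_even hℓ ?_ (even_of_isPackingColoring_five hπ hr hℓ)
    (by omega)
  rintro rfl
  exact not_isPackingColoring_five_genHgraph_five hr hπ
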